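/- Let D = Z_3 × Z_{3^n} (n ≥ 2) and let A be a regular S-ring over D (every basic set containing an element of order 3^n consists of elements of the same order) with rad(A) = e (every highest basic set has trivial radical). Then the subgroup C₁ of order 3 inside the cyclic factor Z_{3^n}, and the subgroup C_{n-1} of order 3^{n-1} inside the cyclic factor, are both A-subgroups. -/

import Mathlib

open scoped BigOperators Pointwise Classical

noncomputable section

/-- The group-ring element `X̄ = Σ_{x∈X} x` in `ℤG`. -/
def ind {G : Type*} [Group G] (X : Finset G) : MonoidAlgebra ℤ G :=
  ∑ x ∈ X, MonoidAlgebra.single x 1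

/-- The ℤ-span of the class sums of the members of `S`. -/
def spanA {G : Type*} [Group G] (S : Finset (Finset G)) :
    Submodule ℤ (MonoidAlgebra ℤ G) :=
  Submodule.span ℤ (ind '' (S : Set (Finset G)))

/-- `S` is the partition of basic sets of an S-ring over `G`. -/
structure IsSRing {G : Type*} [Group G] (S : Finset (Finset G)) : Prop where
  cover : ∀ g : G, ∃ X ∈ S, g ∈ X
  disj : ∀ X ∈ S, ∀ Y ∈ S, X ≠ Y → Disjoint X Y
  nonempty : ∀ X ∈ S, X.Nonempty
  one_mem : ({1} : Finset G) ∈ S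
  inv_mem : ∀ X ∈ S, X.image (·⁻¹) ∈ S
  mul_closed : ∀ a ∈ spanA S, ∀ b ∈ spanA S, a * b ∈ spanA S

/-- `X` is an `A`-set: its class sum lies in the span of the basic class sums. -/
def IsASet {G : Type*} [Group G] (S : Finset (Finset G)) (X : Finset G) : Prop :=
  ind X ∈ spanA S

/-- The finset underlying a subgroup of a finite group. -/
def subgroupFinset {G : Type*} [Group G] [Fintype G] (H : Subgroup G) : Finset G :=
  Finset.univ.filter (· ∈ H)

/-- `H` is an `A`-subgroup. -/
def IsASubgroup {G : Type*} [Group G] [Fintype G] (S : Finset (Finset G))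
    (H : Subgroup G) : Prop :=
  IsASet S (subgroupFinset H)

/-- The radical `rad(X) = {g : gX = Xg = X}` as a subgroup. -/
def radSubgroup {G : Type*} [Group G] (X : Finset G) : Subgroup G where
  carrier := {g : G | X.image (g * ·) = X ∧ X.image (· * g) = X}
  one_mem' := by
    constructor <;> · simp only [one_mul, mul_one]; exact Finset.image_id
  mul_mem' := by
    rintro a b ⟨ha1, ha2⟩ ⟨hb1, hb2⟩
    constructor
    · have : X.image (a * b * ·) = (X.image (b * ·)).image (a * ·) := by
        rw [Finset.image_image]
        exact Finset.image_congr (fun x _ => by simp [mul_assoc])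
      rw [this, hb1, ha1]
    · have : X.image (· * (a * b)) = (X.image (· * a)).image (· * b) := by
        rw [Finset.image_image]
        exact Finset.image_congr (fun x _ => by simp [mul_assoc])
      rw [this, ha2, hb2]
  inv_mem' := by
    rintro a ⟨ha1, ha2⟩
    constructor
    · have := congrArg (Finset.image (a⁻¹ * ·)) ha1
      rw [Finset.image_image] at this
      have h2 : X.image ((a⁻¹ * ·) ∘ (a * ·)) = X := by
        rw [show ((a⁻¹ * ·) ∘ (a * ·)) = id by funext x; simp, Finset.image_id]
      rw [← this, h2]
    · have := congrArg (Finset.image (· * a⁻¹)) ha2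
      rw [Finset.image_image] at this
      have h2 : X.image ((· * a⁻¹) ∘ (· * a)) = X := by
        rw [show ((· * a⁻¹) ∘ (· * a)) = id by funext x; simp, Finset.image_id]
      rw [← this, h2]

end

instance nePow (a k : ℕ) [NeZero a] : NeZero (a ^ k) := ⟨pow_ne_zero k (NeZero.ne a)⟩

/-- The group `D = ℤ₃ × ℤ_{3^n}` (written multiplicatively). -/
abbrev Dgrp (n : ℕ) := Multiplicative (ZMod 3) × Multiplicative (ZMod (3 ^ n))

/-- The subgroup `{x : x^m = 1}` of an abelian group. -/
def expSub (G : Type*) [CommGroup G] (m : ℕ) : Subgroup G where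
  carrier := {x | x ^ m = 1}
  one_mem' := one_pow m
  mul_mem' := by
    intro a b ha hb
    simp only [Set.mem_setOf_eq] at *
    rw [mul_pow, ha, hb, one_mul]
  inv_mem' := by
    intro a ha
    simp only [Set.mem_setOf_eq] at *
    rw [inv_pow, ha, inv_one]


/-- `X` is a union of basic sets. -/
def AS {G : Type*} (S : Finset (Finset G)) (X : Finset G) : Prop :=
  ∀ B ∈ S, ∀ g ∈ B, ∀ h ∈ B, g ∈ X → h ∈ X

theorem ind_coeff {G : Type*} [Group G] (X : Finset G) (g : G) :
    (ind X).coeff g = if g ∈ X then 1 else 0 := by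
  simp [ind, MonoidAlgebra.coeff_sum, Finsupp.single_apply]

theorem span_const {G : Type*} [Group G] {S : Finset (Finset G)} (hS : IsSRing S)
    {a : MonoidAlgebra ℤ G} (ha : a ∈ spanA S) :
    ∀ B ∈ S, ∀ g ∈ B, ∀ h ∈ B, a.coeff g = a.coeff h := by
  intro B hB g hg h hh
  unfold spanA at ha
  induction ha using Submodule.span_induction with
  | mem x hx =>
    obtain ⟨Y, hY, rfl⟩ := hx
    rw [ind_coeff, ind_coeff]
    by_cases hYB : Y = B
    · subst hYB; simp [hg, hh]
    · have := Finset.disjoint_left.1 (hS.disj B hB Y hY (Ne.symm hYB))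
      simp [this hg, this hh]
  | zero => simp
  | add x y _ _ hx hy => simp [hx, hy]
  | smul r x _ hx => rw [MonoidAlgebra.coeff_smul]; simp only [Finsupp.smul_apply, hx]

theorem AS.mem {G : Type*} [Group G] {S : Finset (Finset G)} (hS : IsSRing S)
    {X : Finset G} (hX : AS S X) : ind X ∈ spanA S := by
  have : ind X = ∑ B ∈ S.filter (· ⊆ X), ind B := by
    unfold ind
    rw [← Finset.sum_biUnion]
    · congr 1
      ext g
      simp only [Finset.mem_biUnion, Finset.mem_filter]
      constructor
      · intro hg
        obtain ⟨B, hB, hgB⟩ := hS.cover g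
        exact ⟨B, ⟨hB, fun h hh => hX B hB g hgB h hh hg⟩, hgB⟩
      · rintro ⟨B, ⟨_, hB⟩, hg⟩
        exact hB hg
    · intro B hB C hC hBC
      exact hS.disj B (Finset.mem_filter.1 hB).1 C (Finset.mem_filter.1 hC).1 hBC
  rw [this]
  exact Submodule.sum_mem _ fun B hB =>
    Submodule.subset_span ⟨B, (Finset.mem_filter.1 hB).1, rfl⟩

theorem AS.mul_coeff {G : Type*} [CommGroup G] [DecidableEq G] (X Y : Finset G) (g : G) :
    (ind X * ind Y).coeff g = ((X.filter (fun x => x⁻¹ * g ∈ Y)).card : ℤ) := by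
  rw [ind, Finset.sum_mul]
  simp [MonoidAlgebra.coeff_sum, ind_coeff]

theorem AS.conv {G : Type*} [CommGroup G] [DecidableEq G] {S : Finset (Finset G)} (hS : IsSRing S)
    {X Y : Finset G} (hX : AS S X) (hY : AS S Y) :
    ∀ B ∈ S, ∀ g ∈ B, ∀ h ∈ B, (X.filter (fun x => x⁻¹ * g ∈ Y)).card =
      (X.filter (fun x => x⁻¹ * h ∈ Y)).card := by
  intro B hB g hg h hh
  have := span_const hS (hS.mul_closed _ (hX.mem hS) _ (hY.mem hS)) B hB g hg h hh
  rw [AS.mul_coeff, AS.mul_coeff] at this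
  exact_mod_cast this

theorem ind_one_mem {G : Type*} [Group G] {S : Finset (Finset G)} (hS : IsSRing S) :
    (1 : MonoidAlgebra ℤ G) ∈ spanA S := by
  have : (1 : MonoidAlgebra ℤ G) = ind {1} := by
    simp [ind, MonoidAlgebra.one_def]
  rw [this]
  exact Submodule.subset_span ⟨_, hS.one_mem, rfl⟩

theorem AS.frob {G : Type*} [CommGroup G] [DecidableEq G] [Fintype G] {S : Finset (Finset G)} (hS : IsSRing S)
    {X : Finset G} (hX : AS S X) (q : ℕ) [hq : Fact q.Prime] :
    AS S (Finset.univ.filter (fun g => ¬ q ∣ (X.filter (fun x => x ^ q = g)).card)) := by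
  have hp : ∀ k : ℕ, (ind X) ^ k ∈ spanA S := by
    intro k
    induction k with
    | zero => simpa using ind_one_mem hS
    | succ k ih => rw [pow_succ]; exact hS.mul_closed _ ih _ (hX.mem hS)
  have key : ∀ g : G, ((((ind X) ^ q).coeff g : ℤ) : ZMod q) =
      ((X.filter (fun x => x ^ q = g)).card : ZMod q) := by
    intro g
    have e : MonoidAlgebra.mapRingHom G (Int.castRingHom (ZMod q)) ((ind X) ^ q) =
        ∑ x ∈ X, MonoidAlgebra.single (x ^ q) (1 : ZMod q) := by
      have : CharP (MonoidAlgebra (ZMod q) G) q :=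
        charP_of_injective_algebraMap (algebraMap (ZMod q) _).injective q
      rw [map_pow, ind, map_sum, sum_pow_char q]
      refine Finset.sum_congr rfl fun x _ => ?_
      simp [MonoidAlgebra.single_pow]
    have e2 := congrArg (fun a => a.coeff g) e
    rw [MonoidAlgebra.coeff_mapRingHom] at e2
    simp only [MonoidAlgebra.coeff_sum, MonoidAlgebra.coeff_single, Finsupp.finsetSum_apply,
      Finsupp.single_apply, Finset.sum_boole] at e2
    simpa using e2
  intro B hB g hg h hh hgX
  have := span_const hS (hp q) B hB g hg h hh
  simp only [Finset.mem_filter, Finset.mem_univ, true_and] at hgX ⊢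
  rw [← CharP.cast_eq_zero_iff (ZMod q) q, ← key] at hgX ⊢
  rwa [← this]

theorem AS.powImage {G : Type*} [CommGroup G] [DecidableEq G] [Fintype G] {S : Finset (Finset G)} (hS : IsSRing S)
    (m : ℕ) : (Fintype.card G).Coprime m → ∀ {X : Finset G}, AS S X → AS S (X.image (· ^ m)) := by
  induction m using Nat.recOnMul with
  | zero =>
    intro h X hX
    have h1 : Fintype.card G = 1 := by simpa using h
    have := Fintype.card_le_one_iff_subsingleton.1 h1.le
    convert hX
    ext g
    simp only [Finset.mem_image]
    exact ⟨fun ⟨a, ha, _⟩ => Subsingleton.elim a g ▸ ha, fun h => ⟨g, h, Subsingleton.elim _ _⟩⟩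
  | one => intro _ X hX; simpa using hX
  | prime p hp =>
    intro h X hX
    have := Fact.mk hp
    convert hX.frob hS p using 1
    have inj : Function.Injective (fun x : G => x ^ p) := by
      have := (powCoprime (G := G) (n := p) (by rwa [Nat.card_eq_fintype_card])).injective
      exact this
    ext g
    simp only [Finset.mem_image, Finset.mem_filter, Finset.mem_univ, true_and]
    constructor
    · rintro ⟨x, hx, rfl⟩
      have : X.filter (fun y => y ^ p = x ^ p) = {x} := by
        ext y
        simp only [Finset.mem_filter, Finset.mem_singleton]
        exact ⟨fun h => inj h.2, by rintro rfl; exact ⟨hx, rfl⟩⟩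
      rw [this]
      simpa using hp.one_lt.ne'
    · intro hne
      by_contra hcon
      apply hne
      rw [Finset.filter_false_of_mem]
      · simp
      · intro x hx hxg; exact hcon ⟨x, hx, hxg⟩
  | mul a b ha hb =>
    intro h X hX
    have h1 := Nat.Coprime.coprime_mul_right_right h
    have h2 := Nat.Coprime.coprime_mul_left_right h
    have := hb h2 (ha h1 hX)
    convert this using 1
    rw [Finset.image_image]
    congr 1
    funext x
    simp [pow_mul]

theorem AS.inv {G : Type*} [CommGroup G] [DecidableEq G] [Fintype G] {S : Finset (Finset G)} (hS : IsSRing S)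
    {X : Finset G} (hX : AS S X) : AS S (Finset.univ.filter (fun g => g⁻¹ ∈ X)) := by
  intro B hB g hg h hh hgX
  simp only [Finset.mem_filter, Finset.mem_univ, true_and] at *
  refine hX _ (hS.inv_mem B hB) g⁻¹ ?_ h⁻¹ ?_ hgX <;> simpa

/-- The stabilizer of an A-set is an A-set. -/
theorem AS.rad {G : Type*} [CommGroup G] [DecidableEq G] [Fintype G] {S : Finset (Finset G)} (hS : IsSRing S)
    {X : Finset G} (hX : AS S X) : AS S (Finset.univ.filter (fun g => ∀ x ∈ X, g * x ∈ X)) := by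
  intro B hB g hg h hh hgX
  simp only [Finset.mem_filter, Finset.mem_univ, true_and] at *
  have := AS.conv hS (hX.inv hS) hX B hB g hg h hh
  rw [Finset.filter_true_of_mem] at this
  · have h2 := Finset.card_filter_eq_iff.1 this.symm
    intro x hx
    have := h2 (x := x⁻¹) (by simpa using hx)
    simpa [mul_comm] using this
  · intro x hx
    have := hgX _ (by simpa using hx)
    simpa [mul_comm] using this

/-- The subgroup generated by an A-set. -/
theorem AS.gen {G : Type*} [CommGroup G] [Fintype G] {S : Finset (Finset G)} (hS : IsSRing S)
    {Y : Finset G} (hY : AS S Y) (H : Subgroup G) (hYH : ∀ y ∈ Y, y ∈ H)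
    (y : G) (hy : y ∈ Y) (hgen : ∀ h ∈ H, ∃ k : ℕ, h = y ^ k) :
    AS S (subgroupFinset H) := by
  set K : Finset G := Finset.univ.filter (fun g => ∀ B ∈ S, g ∈ B → ∀ h ∈ B, h ∈ H) with hK
  have hKA : AS S K := by
    intro B hB g hg h hh hgK
    simp only [hK, Finset.mem_filter, Finset.mem_univ, true_and] at *
    intro C hC hhC
    have : C = B := by
      by_contra hne
      exact Finset.disjoint_left.1 (hS.disj C hC B hB hne) hhC hh
    subst this
    exact hgK C hC hg
  have hKH : ∀ g ∈ K, g ∈ H := by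
    intro g hg
    obtain ⟨B, hB, hgB⟩ := hS.cover g
    simp only [hK, Finset.mem_filter, Finset.mem_univ, true_and] at hg
    exact hg B hB hgB g hgB
  have h1 : (1 : G) ∈ K := by
    simp only [hK, Finset.mem_filter, Finset.mem_univ, true_and]
    intro B hB h1B h hh
    have : B = {1} := by
      by_contra hne
      exact Finset.disjoint_left.1 (hS.disj B hB {1} hS.one_mem hne) h1B (by simp)
    subst this
    simp only [Finset.mem_singleton] at hh
    subst hh
    exact H.one_mem
  have hmul : ∀ g ∈ K, g * y ∈ K := by
    intro g hg
    simp only [hK, Finset.mem_filter, Finset.mem_univ, true_and]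
    intro B hB hgB h hh
    have := AS.conv hS hKA hY B hB _ hgB h hh
    have hpos : 0 < (K.filter (fun x => x⁻¹ * (g * y) ∈ Y)).card :=
      Finset.card_pos.2 ⟨g, by simp [hg, hy]⟩
    rw [this] at hpos
    obtain ⟨x, hx⟩ := Finset.card_pos.1 hpos
    rw [Finset.mem_filter] at hx
    have := H.mul_mem (hKH x hx.1) (hYH _ hx.2)
    simpa using this
  have hpow : ∀ k : ℕ, y ^ k ∈ K := by
    intro k
    induction k with
    | zero => simpa using h1
    | succ k ih => rw [pow_succ]; exact hmul _ ih
  have : subgroupFinset H = K := by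
    ext g
    simp only [subgroupFinset, Finset.mem_filter, Finset.mem_univ, true_and]
    constructor
    · intro hg
      obtain ⟨k, rfl⟩ := hgen g hg
      exact hpow k
    · exact hKH g
  rw [this]
  exact hKA

theorem D_card (n : ℕ) : Fintype.card (Dgrp n) = 3 ^ (n + 1) := by
  simp [Dgrp, Fintype.card_prod, ZMod.card, pow_succ, mul_comm]

theorem fst_pow_three {n : ℕ} (x : Dgrp n) (j : ℕ) (hj : 1 ≤ j) : x.1 ^ (3 ^ j) = 1 := by
  obtain ⟨i, rfl⟩ := Nat.exists_eq_add_of_le hj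
  have : x.1 ^ 3 = 1 := by
    have := pow_card_eq_one (x := x.1)
    simpa [ZMod.card] using this
  rw [pow_add, pow_mul, pow_one, this, one_pow]

theorem D_pow_top {n : ℕ} (hn : 1 ≤ n) (x : Dgrp n) : x ^ (3 ^ n) = 1 := by
  ext
  · rw [Prod.pow_fst, fst_pow_three x n hn]; rfl
  · have := pow_card_eq_one (x := x.2)
    rw [Prod.pow_snd]
    simp only [Fintype.card_multiplicative, ZMod.card] at this
    rw [this]; rfl

theorem high_order {n : ℕ} (hn : 1 ≤ n) (x : Dgrp n) (hx : x ^ (3 ^ (n - 1)) ≠ 1) :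
    orderOf x = 3 ^ n := by
  obtain ⟨m, rfl⟩ := Nat.exists_eq_add_of_le' hn
  have := Fact.mk Nat.prime_three
  exact orderOf_eq_prime_pow hx (D_pow_top hn x)

theorem order_high {n : ℕ} (hn : 1 ≤ n) (x : Dgrp n) (hx : orderOf x = 3 ^ n) :
    x ^ (3 ^ (n - 1)) ≠ 1 := by
  intro h
  have := orderOf_dvd_of_pow_eq_one h
  rw [hx] at this
  have := (Nat.pow_dvd_pow_iff_le_right (by norm_num)).1 this
  omega

theorem D_gen {n : ℕ} (hn : 2 ≤ n) (x g : Dgrp n) (hx : x ^ (3 ^ (n - 1)) ≠ 1) (j : ℕ)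
    (hj : 1 ≤ j) (hjn : j ≤ n) (hg1 : g.1 = 1) (hg : g ^ (3 ^ (n - j)) = 1) :
    ∃ k : ℕ, g = x ^ (3 ^ j * k) := by
  obtain ⟨s, d⟩ := x
  obtain ⟨t, c⟩ := g
  have hd : d ^ (3 ^ (n - 1)) ≠ 1 := by
    intro h
    apply hx
    ext
    · have := fst_pow_three (n := n) (s, d) (n - 1) (by omega)
      rw [Prod.pow_fst, this]; rfl
    · rw [Prod.pow_snd, h]; rfl
  have hc : c ^ (3 ^ (n - j)) = 1 := by
    have := congrArg Prod.snd hg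
    simpa using this
  change t = 1 at hg1
  subst hg1
  set d' : ZMod (3 ^ n) := Multiplicative.toAdd d with hd'
  set c' : ZMod (3 ^ n) := Multiplicative.toAdd c with hc'
  have hcz : ((3 ^ (n - j) * c'.val : ℕ) : ZMod (3 ^ n)) = 0 := by
    have := congrArg Multiplicative.toAdd hc
    rw [toAdd_pow, toAdd_one, nsmul_eq_mul] at this
    rw [Nat.cast_mul, ZMod.natCast_zmod_val]
    exact this
  have hdz : ((3 ^ (n - 1) * d'.val : ℕ) : ZMod (3 ^ n)) ≠ 0 := by
    intro h
    apply hd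
    apply Multiplicative.toAdd.injective
    rw [toAdd_pow, toAdd_one, nsmul_eq_mul]
    rw [Nat.cast_mul, ZMod.natCast_zmod_val] at h
    exact h
  rw [ZMod.natCast_eq_zero_iff] at hcz
  rw [Ne, ZMod.natCast_eq_zero_iff] at hdz
  have hd3 : ¬ 3 ∣ d'.val := by
    intro h
    apply hdz
    have := mul_dvd_mul_left (3 ^ (n - 1)) h
    rwa [← pow_succ, Nat.sub_add_cancel (by omega)] at this
  have hc3 : 3 ^ j ∣ c'.val := by
    have e : 3 ^ n = 3 ^ (n - j) * 3 ^ j := by rw [← pow_add]; congr 1; omega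
    have hcz' : 3 ^ (n - j) * 3 ^ j ∣ 3 ^ (n - j) * c'.val := by rw [← e]; exact hcz
    exact Nat.dvd_of_mul_dvd_mul_left (by positivity) hcz'
  obtain ⟨e, he⟩ := hc3
  have hcop : Nat.Coprime d'.val (3 ^ n) := by
    apply Nat.Coprime.pow_right
    exact ((Nat.Prime.coprime_iff_not_dvd Nat.prime_three).2 hd3).symm
  have hu : d' * d'⁻¹ = 1 := by
    have := ZMod.coe_mul_inv_eq_one d'.val hcop
    rwa [ZMod.natCast_zmod_val] at this
  refine ⟨((e : ZMod (3 ^ n)) * d'⁻¹).val, ?_⟩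
  ext
  · rw [Prod.pow_fst, pow_mul]
    have := fst_pow_three (n := n) (s, d) j hj
    rw [this, one_pow]
  · rw [Prod.pow_snd]
    apply Multiplicative.toAdd.injective
    rw [toAdd_pow, nsmul_eq_mul, Nat.cast_mul, ZMod.natCast_zmod_val]
    change c' = _ * d'
    have : c' = ((3 ^ j * e : ℕ) : ZMod (3 ^ n)) := by rw [← he, ZMod.natCast_zmod_val]
    rw [this]
    push_cast
    linear_combination (-(3 ^ j * (e : ZMod (3 ^ n)))) * hu

theorem pi_pow_three {n : ℕ} (hn : 1 ≤ n) (x : Dgrp n) : (x ^ (3 ^ (n - 1))) ^ 3 = 1 := by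
  rw [← pow_mul, ← pow_succ, Nat.sub_add_cancel hn, D_pow_top hn]

theorem pow_mod_three {G : Type*} [Group G] {a : G} (ha : a ^ 3 = 1) (k : ℕ) : a ^ k = a ^ (k % 3) := by
  conv_lhs => rw [← Nat.div_add_mod k 3, pow_add, pow_mul, ha, one_pow, one_mul]

theorem pi_sign {n : ℕ} (hn : 2 ≤ n) (x y : Dgrp n) (hx : x ^ (3 ^ (n - 1)) ≠ 1)
    (hy : y ^ (3 ^ (n - 1)) ≠ 1) :
    y ^ (3 ^ (n - 1)) = x ^ (3 ^ (n - 1)) ∨ y ^ (3 ^ (n - 1)) = (x ^ (3 ^ (n - 1))) ^ 2 := by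
  obtain ⟨k, hk⟩ := D_gen hn x (y ^ (3 ^ (n - 1))) hx (n - 1) (by omega) (by omega)
    (by rw [Prod.pow_fst, fst_pow_three y _ (by omega)])
    (by rw [show n - (n - 1) = 1 by omega, pow_one]; exact pi_pow_three (by omega) y)
  rw [pow_mul, pow_mod_three (pi_pow_three (by omega) x)] at hk
  have : k % 3 = 0 ∨ k % 3 = 1 ∨ k % 3 = 2 := by omega
  rcases this with h | h | h <;> rw [h] at hk
  · rw [pow_zero] at hk; exact absurd hk hy
  · rw [pow_one] at hk; exact Or.inl hk
  · exact Or.inr hk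

/-- A highest basic set with trivial radical. -/
structure Good (n : ℕ) (S : Finset (Finset (Dgrp n))) (X : Finset (Dgrp n)) : Prop where
  mem : X ∈ S
  high : ∀ x ∈ X, x ^ (3 ^ (n - 1)) ≠ 1
  rad : ∀ g : Dgrp n, (∀ x ∈ X, g * x ∈ X) → g = 1

theorem basic_AS {G : Type*} [Group G] {S : Finset (Finset G)} (hS : IsSRing S) {X : Finset G}
    (hX : X ∈ S) : AS S X := by
  intro B hB g hg h hh hgX
  have : X = B := by
    by_contra hne
    exact Finset.disjoint_left.1 (hS.disj X hX B hB hne) hgX hg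
  rwa [this]

theorem cop_card {n m : ℕ} (hm : ¬ 3 ∣ m) : (Fintype.card (Dgrp n)).Coprime m := by
  rw [D_card]
  exact Nat.Coprime.pow_left _ ((Nat.Prime.coprime_iff_not_dvd Nat.prime_three).2 hm)

theorem Good.closed {n : ℕ} {S : Finset (Finset (Dgrp n))} (hS : IsSRing S)
    {X : Finset (Dgrp n)} (hX : Good n S X) {x : Dgrp n} {m : ℕ} (hm : ¬ 3 ∣ m) (hx : x ∈ X)
    (hxm : x ^ m ∈ X) : ∀ y ∈ X, y ^ m ∈ X := by
  have h1 := (basic_AS hS hX.mem).powImage hS m (cop_card hm)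
  have hsub : X ⊆ X.image (· ^ m) := fun y hy =>
    h1 X hX.mem (x ^ m) hxm y hy (Finset.mem_image_of_mem (· ^ m) hx)
  have := Finset.eq_of_subset_of_card_le hsub Finset.card_image_le
  intro y hy
  rw [this]
  exact Finset.mem_image_of_mem (· ^ m) hy

theorem Good.free_aux {n : ℕ} (hn : 2 ≤ n) {S : Finset (Finset (Dgrp n))}
    {X : Finset (Dgrp n)} (hX : Good n S X) (hne : X.Nonempty) (d : ℕ) :
    ∀ j u : ℕ, 1 ≤ j → j + d = n - 1 → ¬ 3 ∣ u → (∀ y ∈ X, y ^ (1 + 3 ^ j * u) ∈ X) → False := by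
  induction d with
  | zero =>
    intro j u hj hjd hu hcl
    have hjn : j = n - 1 := by omega
    subst hjn
    have hit : ∀ l : ℕ, ∀ y ∈ X, y * (y ^ (3 ^ (n - 1))) ^ (u * l) ∈ X := by
      intro l
      induction l with
      | zero => intro y hy; simpa using hy
      | succ l ih =>
        intro y hy
        have h1 := ih _ (hcl y hy)
        have e : (y ^ (1 + 3 ^ (n - 1) * u)) ^ (3 ^ (n - 1)) = y ^ (3 ^ (n - 1)) := by
          rw [← pow_mul, add_mul, pow_add, one_mul]
          have : 3 ^ (n - 1) * u * 3 ^ (n - 1) = 3 ^ n * (u * 3 ^ (n - 2)) := by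
            obtain ⟨i, rfl⟩ := Nat.exists_eq_add_of_le' hn
            simp only [show i + 2 - 1 = i + 1 by omega, Nat.add_sub_cancel]
            ring
          rw [this, pow_mul, D_pow_top (by omega), one_pow, mul_one]
        rw [e] at h1
        convert h1 using 1
        rw [← pow_mul, ← pow_mul, ← pow_succ', ← pow_add]
        congr 1
        ring
    obtain ⟨x, hx⟩ := hne
    have hfin : ∀ k : ℕ, ∀ y ∈ X, y * (y ^ (3 ^ (n - 1))) ^ k ∈ X := by
      intro k y hy
      have : u % 3 = 1 ∨ u % 3 = 2 := by omega
      have h := hit (u * k) y hy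
      rw [pow_mod_three (pi_pow_three (by omega) y)] at h ⊢
      have e : u * (u * k) % 3 = k % 3 := by
        rw [← mul_assoc, Nat.mul_mod, Nat.mul_mod u u]
        rcases this with h | h <;> simp [h]
      rwa [e] at h
    refine hX.high x hx (hX.rad _ ?_)
    intro y hy
    rw [mul_comm]
    rcases pi_sign hn y x (hX.high y hy) (hX.high x hx) with h | h
    · rw [h]; simpa using hfin 1 y hy
    · rw [h]; exact hfin 2 y hy
  | succ d ih =>
    intro j u hj hjd hu hcl
    obtain ⟨i, rfl⟩ := Nat.exists_eq_add_of_le' hj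
    refine ih (i + 1 + 1) (u + 3 * (3 ^ i * u ^ 2 + 3 ^ (2 * i) * u ^ 3)) (by omega) (by omega) (by omega) ?_
    intro y hy
    have := hcl _ (hcl _ (hcl y hy))
    rw [← pow_mul, ← pow_mul] at this
    convert this using 2
    ring

theorem Good.free {n : ℕ} (hn : 2 ≤ n) {S : Finset (Finset (Dgrp n))} (hS : IsSRing S)
    {X : Finset (Dgrp n)} (hX : Good n S X) {x : Dgrp n} {k : ℕ} (hx : x ∈ X)
    (hxm : x ^ (1 + 3 * k) ∈ X) : x ^ (1 + 3 * k) = x := by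
  by_cases hk : 3 ^ n ∣ 3 * k
  · obtain ⟨l, hl⟩ := hk
    rw [hl, pow_add, pow_mul, D_pow_top (by omega), one_pow, pow_one, mul_one]
  exfalso
  have hk0 : 3 * k ≠ 0 := by rintro h; simp [h] at hk
  obtain ⟨j, u, hu, hju⟩ := Nat.exists_eq_pow_mul_and_not_dvd hk0 3 (by norm_num)
  have hj1 : 1 ≤ j := by
    rcases Nat.eq_zero_or_pos j with h | h
    · subst h; simp at hju; omega
    · exact h
  have hjn : j ≤ n - 1 := by
    by_contra hcon
    apply hk
    rw [hju]
    exact Dvd.dvd.mul_right (pow_dvd_pow 3 (by omega)) u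
  have hc := hX.closed hS (m := 1 + 3 * k) (by omega) hx hxm
  rw [hju] at hc
  exact hX.free_aux hn ⟨x, hx⟩ (n - 1 - j) j u hj1 (by omega) hu hc

theorem Good.eq_of {n : ℕ} (hn : 2 ≤ n) {S : Finset (Finset (Dgrp n))} (hS : IsSRing S)
    {X : Finset (Dgrp n)} (hX : Good n S X) {x y : Dgrp n} (hx : x ∈ X) (hy : y ∈ X)
    (h1 : y.1 = x.1) (h2 : y ^ (3 ^ (n - 1)) = x ^ (3 ^ (n - 1))) : y = x := by
  obtain ⟨k, hk⟩ := D_gen hn x (x⁻¹ * y) (hX.high x hx) 1 le_rfl (by omega)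
    (by simp [h1]) (by rw [mul_pow, inv_pow, h2, inv_mul_cancel])
  have e : y = x ^ (1 + 3 * k) := by
    rw [pow_one] at hk
    rw [pow_add, pow_one, ← hk]; simp
  rw [e] at hy ⊢
  exact hX.free hn hS hx hy

theorem Good.inv_of {n : ℕ} (hn : 2 ≤ n) {S : Finset (Finset (Dgrp n))} (hS : IsSRing S)
    {X : Finset (Dgrp n)} (hX : Good n S X) {x y : Dgrp n} (hx : x ∈ X) (hy : y ∈ X)
    (h1 : y.1 = x.1 ^ 2) (h2 : y ^ (3 ^ (n - 1)) = (x ^ (3 ^ (n - 1))) ^ 2) : y = x⁻¹ := by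
  obtain ⟨k, hk⟩ := D_gen hn x ((x ^ 2)⁻¹ * y) (hX.high x hx) 1 le_rfl (by omega)
    (by simp [h1])
    (by rw [mul_pow, inv_pow, h2, ← pow_mul, ← pow_mul, mul_comm 2, inv_mul_cancel])
  have e : y = x ^ (2 + 3 * k) := by
    rw [pow_one] at hk
    rw [pow_add, ← hk]; simp
  rw [e] at hy ⊢
  have hcl := hX.closed hS (m := 2 + 3 * k) (by omega) hx hy _ hy
  rw [← pow_mul] at hcl
  have e2 : (2 + 3 * k) * (2 + 3 * k) = 1 + 3 * (1 + 4 * k + 3 * k * k) := by ring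
  rw [e2] at hcl
  have h3 := hX.free hn hS hx hcl
  have h4 : x ^ ((1 + 3 * k) * (2 + 3 * k + 1)) = 1 := by
    have : (1 + 3 * k) * (2 + 3 * k + 1) = 3 * (1 + 4 * k + 3 * k * k) := by ring
    rw [this]
    rwa [pow_add, pow_one, mul_eq_left] at h3
  have h5 := orderOf_dvd_of_pow_eq_one h4
  have ho := high_order (by omega) x (hX.high x hx)
  have h6 : orderOf x ∣ 2 + 3 * k + 1 := by
    refine Nat.Coprime.dvd_of_dvd_mul_left ?_ h5
    rw [ho]
    exact Nat.Coprime.pow_left _ ((Nat.Prime.coprime_iff_not_dvd Nat.prime_three).2 (by omega))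
  rw [eq_inv_iff_mul_eq_one, ← pow_succ]
  exact orderOf_dvd_iff_pow_eq_one.1 h6

theorem prod_three {G : Type*} [CommGroup G] {P : Finset G} (hP : P.card = 3) {a b : G}
    (hab : a ≠ b) (ha : a ∈ P) (hb : b ∈ P) :
    ∃ c ∈ P, (∏ x ∈ P, x) = a * b * c ∧ ∀ x ∈ P, x = a ∨ x = b ∨ x = c := by
  have hb' : b ∈ P.erase a := Finset.mem_erase.2 ⟨hab.symm, hb⟩
  have h1 : ((P.erase a).erase b).card = 1 := by
    rw [Finset.card_erase_of_mem hb', Finset.card_erase_of_mem ha, hP]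
  obtain ⟨c, hc⟩ := Finset.card_eq_one.1 h1
  have hcP : c ∈ (P.erase a).erase b := by rw [hc]; simp
  refine ⟨c, Finset.mem_of_mem_erase (Finset.mem_of_mem_erase hcP), ?_, ?_⟩
  · rw [← Finset.mul_prod_erase P (fun x => x) ha, ← Finset.mul_prod_erase _ (fun x => x) hb', hc]
    simp [mul_assoc]
  · intro x hx
    by_cases hxa : x = a
    · exact Or.inl hxa
    by_cases hxb : x = b
    · exact Or.inr (Or.inl hxb)
    have : x ∈ (P.erase a).erase b := by simp [hxa, hxb, hx]
    rw [hc] at this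
    exact Or.inr (Or.inr (Finset.mem_singleton.1 this))

theorem shift_three {G : Type*} [CommGroup G] {P : Finset G} (hP : P.card = 3) {w a b : G}
    (hw : w ^ 3 = 1) (hab : a ≠ b) (ha : a ∈ P) (hb : b ∈ P) (hwa : w * a ∈ P) (hwb : w * b ∈ P) :
    ∀ x ∈ P, w * x ∈ P := by
  obtain ⟨c, hc, hprod, hall⟩ := prod_three hP hab ha hb
  obtain ⟨d, hd, hprod', _⟩ := prod_three hP (fun h => hab (mul_left_cancel h)) hwa hwb
  have e : w * c = d := by
    rw [hprod] at hprod'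
    have h1 : a * b * c = a * b * (w ^ 2 * d) := by rw [hprod', pow_two]; ac_rfl
    have h2 := mul_left_cancel h1
    rw [h2, ← mul_assoc, ← pow_succ', hw, one_mul]
  intro x hx
  rcases hall x hx with rfl | rfl | rfl
  · exact hwa
  · exact hwb
  · rw [e]; exact hd

theorem Good.P_inj {n : ℕ} (hn : 2 ≤ n) {S : Finset (Finset (Dgrp n))} (hS : IsSRing S)
    {X : Finset (Dgrp n)} (hX : Good n S X) (p : Dgrp n) :
    Set.InjOn Prod.fst ((X.filter (fun y => y ^ (3 ^ (n - 1)) = p) : Finset (Dgrp n)) : Set (Dgrp n)) := by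
  intro a ha b hb hab
  rw [Finset.mem_coe, Finset.mem_filter] at ha hb
  exact hX.eq_of hn hS hb.1 ha.1 hab (ha.2.trans hb.2.symm)

theorem Good.P_card {n : ℕ} (hn : 2 ≤ n) {S : Finset (Finset (Dgrp n))} (hS : IsSRing S)
    {X : Finset (Dgrp n)} (hX : Good n S X) (p : Dgrp n) :
    (X.filter (fun y => y ^ (3 ^ (n - 1)) = p)).card ≤ 3 := by
  have := Finset.card_le_card_of_injOn (t := Finset.univ) Prod.fst (fun _ _ => Finset.mem_univ _)
    (hX.P_inj hn hS p)
  simpa [Finset.card_univ, ZMod.card] using this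

theorem Good.card_le {n : ℕ} (hn : 2 ≤ n) {S : Finset (Finset (Dgrp n))} (hS : IsSRing S)
    {X : Finset (Dgrp n)} (hX : Good n S X) : X.card ≤ 6 := by
  rcases X.eq_empty_or_nonempty with h | ⟨x, hx⟩
  · simp [h]
  have hsub : X ⊆ X.filter (fun y => y ^ (3 ^ (n - 1)) = x ^ (3 ^ (n - 1))) ∪
      X.filter (fun y => y ^ (3 ^ (n - 1)) = (x ^ (3 ^ (n - 1))) ^ 2) := by
    intro y hy
    rw [Finset.mem_union, Finset.mem_filter, Finset.mem_filter]
    rcases pi_sign hn x y (hX.high x hx) (hX.high y hy) with h | h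
    · exact Or.inl ⟨hy, h⟩
    · exact Or.inr ⟨hy, h⟩
  have h1 := Finset.card_le_card hsub
  have h2 := h1.trans (Finset.card_union_le _ _)
  have h3 := hX.P_card hn hS (x ^ (3 ^ (n - 1)))
  have h4 := hX.P_card hn hS ((x ^ (3 ^ (n - 1))) ^ 2)
  omega

theorem cube_pi {n : ℕ} (hn : 2 ≤ n) {x y : Dgrp n} (h : y ^ 3 = x ^ 3) :
    y ^ (3 ^ (n - 1)) = x ^ (3 ^ (n - 1)) := by
  have : 3 ^ (n - 1) = 3 * 3 ^ (n - 2) := by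
    rw [← pow_succ']; congr 1; omega
  rw [this, pow_mul, pow_mul, h]

theorem Good.caseII {n : ℕ} (hn : 2 ≤ n) {S : Finset (Finset (Dgrp n))} (hS : IsSRing S)
    (HA : AS S (Finset.univ.filter (fun g : Dgrp n => g ^ (3 ^ (n - 1)) = 1)))
    {X : Finset (Dgrp n)} (hX : Good n S X) (hne : X.Nonempty)
    (hII : ∀ g, 3 ∣ (X.filter (fun x => x ^ 3 = g)).card) :
    ∃ Y : Finset (Dgrp n), AS S Y ∧ Y.Nonempty ∧ Y ⊆ X.image (· ^ 3) := by
  have hfib : ∀ x ∈ X, X.filter (fun y => y ^ 3 = x ^ 3) =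
      X.filter (fun y => y ^ (3 ^ (n - 1)) = x ^ (3 ^ (n - 1))) ∧
      (X.filter (fun y => y ^ (3 ^ (n - 1)) = x ^ (3 ^ (n - 1)))).card = 3 := by
    intro x hx
    have hsub : X.filter (fun y => y ^ 3 = x ^ 3) ⊆
        X.filter (fun y => y ^ (3 ^ (n - 1)) = x ^ (3 ^ (n - 1))) := by
      intro y hy
      rw [Finset.mem_filter] at hy ⊢
      exact ⟨hy.1, cube_pi hn hy.2⟩
    have h1 := hX.P_card hn hS (x ^ (3 ^ (n - 1)))
    have h2 := Nat.le_of_dvd (Finset.card_pos.2 ⟨x, by simp [hx]⟩) (hII (x ^ 3))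
    have h3 := Finset.card_le_card hsub
    exact ⟨Finset.eq_of_subset_of_card_le hsub (by omega), by omega⟩
  have hcube : ∀ x ∈ X, ∀ y ∈ X, y ^ (3 ^ (n - 1)) = x ^ (3 ^ (n - 1)) → y ^ 3 = x ^ 3 := by
    intro x hx y hy h
    have : y ∈ X.filter (fun y => y ^ (3 ^ (n - 1)) = x ^ (3 ^ (n - 1))) :=
      Finset.mem_filter.2 ⟨hy, h⟩
    rw [← (hfib x hx).1] at this
    exact (Finset.mem_filter.1 this).2
  have hsurj : ∀ x ∈ X, ∀ t, ∃ y ∈ X, y ^ (3 ^ (n - 1)) = x ^ (3 ^ (n - 1)) ∧ y.1 = t := by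
    intro x hx t
    have h1 := Finset.card_image_of_injOn (hX.P_inj hn hS (x ^ (3 ^ (n - 1))))
    rw [(hfib x hx).2] at h1
    have h2 := (Finset.card_eq_iff_eq_univ _).1 (h1.trans
      (by simp [ZMod.card] : 3 = Fintype.card (Multiplicative (ZMod 3))))
    have h3 := Finset.mem_univ t
    rw [← h2, Finset.mem_image] at h3
    obtain ⟨y, hy, hyt⟩ := h3
    rw [Finset.mem_filter] at hy
    exact ⟨y, hy.1, hy.2, hyt⟩
  have hinv : ∀ x ∈ X, ∀ v ∈ X, v ^ (3 ^ (n - 1)) = (x ^ (3 ^ (n - 1))) ^ 2 → x⁻¹ ∈ X := by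
    intro x hx v hv h
    obtain ⟨y, hy, hy2, hy1⟩ := hsurj v hv (x.1 ^ 2)
    rw [← hX.inv_of hn hS hx hy hy1 (hy2.trans h)]
    exact hy
  have hp4 : ∀ x : Dgrp n, (x ^ (3 ^ (n - 1))) ^ 4 = x ^ (3 ^ (n - 1)) := by
    intro x
    rw [pow_succ, pi_pow_three (by omega), one_mul]
  have hsq : ∀ x v : Dgrp n, v ^ (3 ^ (n - 1)) = (x ^ (3 ^ (n - 1))) ^ 2 →
      x ^ (3 ^ (n - 1)) = (v ^ (3 ^ (n - 1))) ^ 2 := by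
    intro x v h
    rw [h, ← pow_mul, hp4]
  have hinvpi : ∀ x v : Dgrp n, v ^ (3 ^ (n - 1)) = (x ^ (3 ^ (n - 1))) ^ 2 →
      v⁻¹ ^ (3 ^ (n - 1)) = x ^ (3 ^ (n - 1)) := by
    intro x v h
    rw [inv_pow, h, inv_eq_iff_mul_eq_one, ← pow_succ, pi_pow_three (by omega)]
  have hw1 : ∀ w : Dgrp n, ∀ a ∈ X, ∀ b ∈ X, w ^ 3 = 1 → a ≠ b →
      b ^ (3 ^ (n - 1)) = a ^ (3 ^ (n - 1)) → w * a ∈ X → w * b ∈ X → w = 1 := by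
    intro w a ha b hb hw hab hpi hwa hwb
    have hpw : w ^ (3 ^ (n - 1)) = 1 := by
      have := cube_pi hn (x := 1) (y := w) (by rw [hw, one_pow])
      rwa [one_pow] at this
    have hmem : ∀ y : Dgrp n, y ∈ X.filter (fun y => y ^ (3 ^ (n - 1)) = a ^ (3 ^ (n - 1))) ↔
        y ∈ X ∧ y ^ (3 ^ (n - 1)) = a ^ (3 ^ (n - 1)) := fun y => Finset.mem_filter
    have hsh := shift_three (hfib a ha).2 hw hab ((hmem a).2 ⟨ha, rfl⟩) ((hmem b).2 ⟨hb, hpi⟩)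
      ((hmem _).2 ⟨hwa, by rw [mul_pow, hpw, one_mul]⟩)
      ((hmem _).2 ⟨hwb, by rw [mul_pow, hpw, one_mul, hpi]⟩)
    apply hX.rad
    intro v hv
    rcases pi_sign hn a v (hX.high a ha) (hX.high v hv) with h | h
    · exact ((hmem _).1 (hsh v ((hmem v).2 ⟨hv, h⟩))).1
    · have h1 : v⁻¹ ∈ X := hinv v hv a ha (hsq a v h)
      have h2 := (hmem _).1 (hsh _ (hsh _ ((hmem v⁻¹).2 ⟨h1, hinvpi a v h⟩)))
      have h3 := hinv _ h2.1 v hv (by rw [h2.2, h])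
      have e : (w * (w * v⁻¹))⁻¹ = w * v := by
        rw [mul_inv, mul_inv, inv_inv, ← mul_assoc]
        congr 1
        rw [← mul_inv, inv_eq_iff_mul_eq_one, ← pow_two, ← pow_succ, hw]
      rwa [e] at h3
  obtain ⟨x0, hx0⟩ := hne
  have hXA := basic_AS hS hX.mem
  set Z := X.image (· ^ 4) with hZ
  set V : Finset (Dgrp n) := Finset.univ.filter (fun g => g⁻¹ ∈ X) with hV
  have hZA : AS S Z := hXA.powImage hS 4 (cop_card (by norm_num))
  have hVA : AS S V := hXA.inv hS
  have hVm : ∀ g : Dgrp n, g ∈ V ↔ g⁻¹ ∈ X := by intro g; simp [hV]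
  refine ⟨Finset.univ.filter (fun g => g ^ (3 ^ (n - 1)) = 1 ∧
    3 ≤ (Z.filter (fun x => x⁻¹ * g ∈ V)).card), ?_, ⟨x0 ^ 3, ?_⟩, ?_⟩
  · intro B hB g hg h hh hgT
    have h1 := HA B hB g hg h hh
    have h2 := AS.conv hS hZA hVA B hB g hg h hh
    simp only [Finset.mem_filter, Finset.mem_univ, true_and] at h1 hgT ⊢
    exact ⟨h1 hgT.1, h2 ▸ hgT.2⟩
  · simp only [Finset.mem_filter, Finset.mem_univ, true_and]
    constructor
    · rw [← pow_mul, mul_comm, pow_mul, pi_pow_three (by omega)]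
    · have hc3 : (X.filter (fun y => y ^ 3 = x0 ^ 3)).card = 3 := by
        rw [(hfib x0 hx0).1]; exact (hfib x0 hx0).2
      refine hc3.symm.le.trans ?_
      apply Finset.card_le_card_of_injOn (· ^ 4)
      · intro y hy
        rw [Finset.mem_coe, Finset.mem_filter] at hy
        rw [Finset.mem_coe, Finset.mem_filter]
        refine ⟨Finset.mem_image.2 ⟨y, hy.1, rfl⟩, ?_⟩
        rw [hVm, ← hy.2]
        convert hy.1 using 1
        simp only [mul_inv, inv_inv]
        rw [pow_succ' y 3, mul_inv_cancel_right]
      · intro y hy z hz hyz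
        rw [Finset.mem_coe, Finset.mem_filter] at hy hz
        simp only at hyz
        rw [pow_succ' y 3, pow_succ' z 3, hy.2, hz.2] at hyz
        exact mul_right_cancel hyz
  · intro g hg
    simp only [Finset.mem_filter, Finset.mem_univ, true_and] at hg
    obtain ⟨hgH, hg3⟩ := hg
    have hF : ∀ u ∈ Z.filter (fun x => x⁻¹ * g ∈ V), ∃ y ∈ X, u = y ^ 4 ∧ g⁻¹ * y ^ 4 ∈ X := by
      intro u hu
      rw [Finset.mem_filter, hVm] at hu
      obtain ⟨y, hy, rfl⟩ := Finset.mem_image.1 hu.1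
      refine ⟨y, hy, rfl, ?_⟩
      convert hu.2 using 1
      simp only [mul_inv, inv_inv]
      rw [mul_comm]
    have hpig := Finset.exists_ne_map_eq_of_card_lt_of_maps_to
      (s := Z.filter (fun x => x⁻¹ * g ∈ V))
      (t := {x0 ^ (3 ^ (n - 1)), (x0 ^ (3 ^ (n - 1))) ^ 2}) (f := fun u => u ^ (3 ^ (n - 1)))
      (lt_of_le_of_lt Finset.card_le_two (by omega)) (by
        intro u hu
        obtain ⟨y, hy, rfl, _⟩ := hF u hu
        have e : (y ^ 4) ^ (3 ^ (n - 1)) = y ^ (3 ^ (n - 1)) := by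
          rw [← pow_mul, mul_comm, pow_mul, hp4]
        simp only [Finset.coe_insert, Finset.coe_singleton, Set.mem_insert_iff,
          Set.mem_singleton_iff]
        rw [e]
        exact pi_sign hn x0 y (hX.high _ hx0) (hX.high _ hy))
    obtain ⟨u, hu, v, hv, huv, hpi⟩ := hpig
    obtain ⟨a, ha, rfl, hga⟩ := hF u hu
    obtain ⟨b, hb, rfl, hgb⟩ := hF v hv
    have hpi' : b ^ (3 ^ (n - 1)) = a ^ (3 ^ (n - 1)) := by
      rw [← pow_mul, ← pow_mul, mul_comm, pow_mul, pow_mul, hp4, hp4] at hpi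
      exact hpi.symm
    have hba := hcube a ha b hb hpi'
    have e1 : g⁻¹ * a ^ 3 * a = g⁻¹ * a ^ 4 := by rw [mul_assoc, ← pow_succ]
    have e2 : g⁻¹ * a ^ 3 * b = g⁻¹ * b ^ 4 := by rw [mul_assoc, ← hba, ← pow_succ]
    have hw3 : (g⁻¹ * a ^ 3) ^ 3 = 1 := by
      have := hcube a ha _ hga (by
        rw [mul_pow, inv_pow, hgH, inv_one, one_mul, ← pow_mul, mul_comm, pow_mul, hp4])
      rw [← e1, mul_pow] at this
      exact mul_eq_right.1 this
    have := hw1 (g⁻¹ * a ^ 3) a ha b hb hw3 (by rintro rfl; exact huv rfl) hpi'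
      (by rw [e1]; exact hga) (by rw [e2]; exact hgb)
    rw [inv_mul_eq_one] at this
    rw [this]
    exact Finset.mem_image.2 ⟨a, ha, rfl⟩

theorem Good.exists_Y {n : ℕ} (hn : 2 ≤ n) {S : Finset (Finset (Dgrp n))} (hS : IsSRing S)
    (HA : AS S (Finset.univ.filter (fun g : Dgrp n => g ^ (3 ^ (n - 1)) = 1)))
    {X : Finset (Dgrp n)} (hX : Good n S X) (hne : X.Nonempty) :
    ∃ Y : Finset (Dgrp n), AS S Y ∧ Y.Nonempty ∧ Y ⊆ X.image (· ^ 3) := by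
  by_cases hII : ∀ g, 3 ∣ (X.filter (fun x => x ^ 3 = g)).card
  · exact hX.caseII hn hS HA hne hII
  push Not at hII
  obtain ⟨g, hg⟩ := hII
  have := Fact.mk Nat.prime_three
  refine ⟨_, (basic_AS hS hX.mem).frob hS 3, ⟨g, by simpa using hg⟩, ?_⟩
  intro h hh
  simp only [Finset.mem_filter, Finset.mem_univ, true_and] at hh
  have : (X.filter (fun x => x ^ 3 = h)).Nonempty := by
    by_contra hcon
    rw [Finset.not_nonempty_iff_eq_empty] at hcon
    rw [hcon] at hh
    simp at hh
  obtain ⟨x, hx⟩ := this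
  rw [Finset.mem_filter] at hx
  exact Finset.mem_image.2 ⟨x, hx⟩

theorem mem_C {n : ℕ} (m : ℕ) (g : Dgrp n) :
    g ∈ (⊥ : Subgroup (Multiplicative (ZMod 3))).prod
      (expSub (Multiplicative (ZMod (3 ^ n))) m) ↔ g.1 = 1 ∧ g ^ m = 1 := by
  rw [Subgroup.mem_prod, Subgroup.mem_bot]
  constructor
  · rintro ⟨h1, h2⟩
    refine ⟨h1, ?_⟩
    ext
    · rw [Prod.pow_fst, h1, one_pow]; rfl
    · rw [Prod.pow_snd]; exact congrArg _ h2
  · rintro ⟨h1, h2⟩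
    exact ⟨h1, congrArg Prod.snd h2⟩

theorem C1_mem {n : ℕ} (hn : 2 ≤ n) {x g : Dgrp n} (hx : x ^ (3 ^ (n - 1)) ≠ 1) (h1 : g.1 = 1)
    (h3 : g ^ 3 = 1) :
    g ∈ ({1, x ^ (3 ^ (n - 1)), (x ^ (3 ^ (n - 1))) ^ 2} : Finset (Dgrp n)) := by
  obtain ⟨k, hk⟩ := D_gen hn x g hx (n - 1) (by omega) (by omega) h1
    (by rw [show n - (n - 1) = 1 by omega, pow_one]; exact h3)
  rw [pow_mul, pow_mod_three (pi_pow_three (by omega) x)] at hk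
  have : k % 3 = 0 ∨ k % 3 = 1 ∨ k % 3 = 2 := by omega
  rcases this with h | h | h <;> rw [h] at hk <;> simp [hk]

theorem C1_of {n : ℕ} (hn : 2 ≤ n) {S : Finset (Finset (Dgrp n))} (hS : IsSRing S) (d : ℕ) :
    ∀ (j : ℕ) (Y : Finset (Dgrp n)), 1 ≤ j → j + d = n - 1 → AS S Y → Y.Nonempty → Y.card ≤ 6 →
      (∀ y ∈ Y, ∃ x : Dgrp n, x ^ (3 ^ (n - 1)) ≠ 1 ∧ y = x ^ (3 ^ j)) →
      AS S (subgroupFinset ((⊥ : Subgroup (Multiplicative (ZMod 3))).prod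
        (expSub (Multiplicative (ZMod (3 ^ n))) 3))) := by
  induction d with
  | zero =>
    intro j Y hj hjd hY hne hcard hYx
    have hjn : j = n - 1 := by omega
    subst hjn
    obtain ⟨y, hy⟩ := hne
    refine hY.gen hS _ ?_ y hy ?_
    · intro z hz
      obtain ⟨x, hx, rfl⟩ := hYx z hz
      rw [mem_C]
      exact ⟨by rw [Prod.pow_fst, fst_pow_three x _ hj], pi_pow_three (by omega) x⟩
    · intro h hh
      rw [mem_C] at hh
      obtain ⟨x, hx, rfl⟩ := hYx y hy
      obtain ⟨k, hk⟩ := D_gen hn x h hx (n - 1) (by omega) (by omega) hh.1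
        (by rw [show n - (n - 1) = 1 by omega, pow_one]; exact hh.2)
      exact ⟨k, by rw [hk, pow_mul]⟩
  | succ d ih =>
    intro j Y hj hjd hY hne hcard hYx
    have h3p := Fact.mk Nat.prime_three
    by_cases hII : ∀ g, 3 ∣ (Y.filter (fun x => x ^ 3 = g)).card
    · have hR := hY.rad hS
      convert hR using 1
      have hfst : ∀ y ∈ Y, y.1 = 1 := by
        intro y hy
        obtain ⟨x, _, rfl⟩ := hYx y hy
        rw [Prod.pow_fst, fst_pow_three x _ hj]
      ext g
      simp only [subgroupFinset, Finset.mem_filter, Finset.mem_univ, true_and]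
      rw [mem_C]
      constructor
      · rintro ⟨hg1, hg3⟩ y hy
        obtain ⟨x, hx, hyx⟩ := hYx y hy
        have hsub : Y.filter (fun z => z ^ 3 = y ^ 3) ⊆
            ({1, x ^ (3 ^ (n - 1)), (x ^ (3 ^ (n - 1))) ^ 2} : Finset (Dgrp n)).image (· * y) := by
          intro z hz
          rw [Finset.mem_filter] at hz
          refine Finset.mem_image.2 ⟨z * y⁻¹, C1_mem hn hx ?_ ?_, by simp⟩
          · simp [hfst z hz.1, hfst y hy]
          · rw [mul_pow, inv_pow, hz.2, mul_inv_cancel]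
        have h1 := Nat.le_of_dvd (Finset.card_pos.2 ⟨y, by simp [hy]⟩) (hII (y ^ 3))
        have h2 := Finset.eq_of_subset_of_card_le hsub
          (Finset.card_image_le.trans (Finset.card_le_three.trans h1))
        have h3 : g * y ∈ Y.filter (fun z => z ^ 3 = y ^ 3) := by
          rw [h2]
          exact Finset.mem_image.2 ⟨g, C1_mem hn hx hg1 hg3, rfl⟩
        exact (Finset.mem_filter.1 h3).1
      · intro hg
        obtain ⟨y, hy⟩ := hne
        have hg1 : g.1 = 1 := by
          have := hfst _ (hg y hy)
          rwa [Prod.fst_mul, hfst y hy, mul_one] at this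
        refine ⟨hg1, ?_⟩
        have hpow : ∀ k : ℕ, g ^ k * y ∈ Y := by
          intro k
          induction k with
          | zero => simpa using hy
          | succ k ih => rw [pow_succ', mul_assoc]; exact hg _ ih
        have hle : orderOf g ≤ 6 := by
          have := Finset.card_le_card_of_injOn (s := Finset.range (orderOf g)) (t := Y)
            (fun k => g ^ k * y) (fun k _ => hpow k) (by
              intro a ha b hb hab
              simp only [Finset.coe_range, Set.mem_Iio] at ha hb
              exact pow_injOn_Iio_orderOf ha hb (mul_right_cancel hab))
          rw [Finset.card_range] at this
          omega
        obtain ⟨i, _, hi⟩ := (Nat.dvd_prime_pow Nat.prime_three).1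
          (orderOf_dvd_of_pow_eq_one (D_pow_top (by omega) g))
        have hi1 : i ≤ 1 := by
          by_contra hcon
          have : 3 ^ 2 ≤ 3 ^ i := Nat.pow_le_pow_right (by norm_num) (by omega)
          omega
        apply orderOf_dvd_iff_pow_eq_one.1
        rw [hi]
        exact (pow_dvd_pow 3 hi1).trans (by norm_num)
    · push Not at hII
      obtain ⟨g, hg⟩ := hII
      have hsub : (Finset.univ.filter (fun g => ¬ 3 ∣ (Y.filter (fun x => x ^ 3 = g)).card)) ⊆
          Y.image (· ^ 3) := by
        intro h hh
        simp only [Finset.mem_filter, Finset.mem_univ, true_and] at hh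
        have : (Y.filter (fun x => x ^ 3 = h)).Nonempty := by
          by_contra hcon
          rw [Finset.not_nonempty_iff_eq_empty] at hcon
          rw [hcon] at hh
          simp at hh
        obtain ⟨x, hx⟩ := this
        rw [Finset.mem_filter] at hx
        exact Finset.mem_image.2 ⟨x, hx⟩
      refine ih (j + 1) _ (by omega) (by omega) (hY.frob hS 3) ⟨g, by simpa using hg⟩
        ((Finset.card_le_card hsub).trans (Finset.card_image_le.trans hcard)) ?_
      intro z hz
      obtain ⟨y, hy, rfl⟩ := Finset.mem_image.1 (hsub hz)
      obtain ⟨x, hx, rfl⟩ := hYx y hy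
      exact ⟨x, hx, by rw [← pow_mul, ← pow_succ]⟩

/-- for a regular S-ring over `D` with `rad(A) = e`, the
subgroups `C₁` (of order 3) and `C_{n-1}` (of order `3^{n-1}`) of the cyclic
factor are `A`-subgroups. -/
theorem stmt13 (n : ℕ) (hn : 2 ≤ n) (S : Finset (Finset (Dgrp n)))
    (hS : IsSRing S)
    (hreg : ∀ X ∈ S, (∃ x ∈ X, orderOf x = 3 ^ n) →
      ∀ a ∈ X, ∀ b ∈ X, orderOf a = orderOf b)
    (hrad : ∀ X ∈ S, (∃ x ∈ X, orderOf x = 3 ^ n) →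
      ∀ g : Dgrp n, X.image (g * ·) = X → g = 1) :
    IsASubgroup S ((⊥ : Subgroup (Multiplicative (ZMod 3))).prod
      (expSub (Multiplicative (ZMod (3 ^ n))) 3)) ∧
    IsASubgroup S ((⊥ : Subgroup (Multiplicative (ZMod 3))).prod
      (expSub (Multiplicative (ZMod (3 ^ n))) (3 ^ (n - 1)))) := by
  have HA : AS S (Finset.univ.filter (fun g : Dgrp n => g ^ (3 ^ (n - 1)) = 1)) := by
    intro B hB g hg h hh hg1
    simp only [Finset.mem_filter, Finset.mem_univ, true_and] at hg1 ⊢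
    by_contra hne
    have ho := high_order (by omega) h hne
    have := hreg B hB ⟨h, hh, ho⟩ g hg h hh
    exact order_high (by omega) g (this.trans ho) hg1
  obtain ⟨x, hx⟩ : ∃ x : Dgrp n, orderOf x = 3 ^ n := by
    refine ⟨(1, Multiplicative.ofAdd 1), ?_⟩
    rw [Prod.orderOf_mk, orderOf_one, orderOf_ofAdd_eq_addOrderOf, ZMod.addOrderOf_one]
    simp
  obtain ⟨X, hXS, hxX⟩ := hS.cover x
  have hX : Good n S X := by
    refine ⟨hXS, ?_, ?_⟩
    · intro y hy
      exact order_high (by omega) y ((hreg X hXS ⟨x, hxX, hx⟩ y hy x hxX).trans hx)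
    · intro g hg
      apply hrad X hXS ⟨x, hxX, hx⟩ g
      apply Finset.eq_of_subset_of_card_le
      · intro y hy
        obtain ⟨z, hz, rfl⟩ := Finset.mem_image.1 hy
        exact hg z hz
      · rw [Finset.card_image_of_injective _ (mul_right_injective g)]
  obtain ⟨Y, hYA, hYne, hYX⟩ := hX.exists_Y hn hS HA ⟨x, hxX⟩
  have hYx : ∀ y ∈ Y, ∃ x : Dgrp n, x ^ (3 ^ (n - 1)) ≠ 1 ∧ y = x ^ (3 ^ 1) := by
    intro y hy
    obtain ⟨z, hz, rfl⟩ := Finset.mem_image.1 (hYX hy)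
    exact ⟨z, hX.high z hz, by rw [pow_one]⟩
  constructor
  · exact (C1_of hn hS (n - 2) 1 Y le_rfl (by omega) hYA hYne
      ((Finset.card_le_card hYX).trans (Finset.card_image_le.trans (hX.card_le hn hS))) hYx).mem hS
  · obtain ⟨y, hy⟩ := hYne
    refine (hYA.gen hS _ ?_ y hy ?_).mem hS
    · intro z hz
      obtain ⟨w, hw, rfl⟩ := hYx z hz
      rw [mem_C]
      refine ⟨by rw [Prod.pow_fst, fst_pow_three w _ le_rfl], ?_⟩
      rw [← pow_mul, ← pow_add, show 1 + (n - 1) = n by omega, D_pow_top (by omega)]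
    · intro h hh
      rw [mem_C] at hh
      obtain ⟨w, hw, rfl⟩ := hYx y hy
      obtain ⟨k, hk⟩ := D_gen hn w h hw 1 le_rfl (by omega) hh.1 hh.2
      exact ⟨k, by rw [hk, pow_mul]⟩
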